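/- arXiv:2502.19859 — 5 statements merged into one kernel-verified Lean document; each statement's English description precedes it below -/
import Mathlib

section
/- Let n be a natural number with n ≥ 2 and let γ ∈ [0, 1). Then 1 / (1 − γ^{1/log₂ n}) ≤ (log₂ n + 2) / (1 − γ), where γ^{1/log₂ n} denotes the real power of γ with exponent 1/log₂ n. -/
/-- The effective horizon of the binarized MDP, with discount factor
`γ ^ (1 / log₂ n)`, is at most `log₂ n + 2` times the effective horizon
of the original MDP. -/
theorem binarized_effective_horizon (n : ℕ) (hn : 2 ≤ n) (γ : ℝ)
    (hγ0 : 0 ≤ γ) (hγ1 : γ < 1) :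
    1 / (1 - γ ^ ((1 : ℝ) / Real.logb 2 n)) ≤ (Real.logb 2 n + 2) / (1 - γ) := by
  have hL : 1 ≤ Real.logb 2 n := by
    rw [Real.le_logb_iff_rpow_le one_lt_two (by positivity), Real.rpow_one]
    exact_mod_cast hn
  generalize Real.logb 2 n = L at hL ⊢
  have hL0 : 0 < L := by linarith
  have bernoulli : γ ^ (1 / L) ≤ 1 + 1 / L * (γ - 1) := by
    simpa using rpow_one_add_le_one_add_mul_self (s := γ - 1) (by linarith)
      (one_div_nonneg.mpr hL0.le) ((div_le_one hL0).mpr hL)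
  have hγ : 0 < 1 - γ := by linarith
  calc 1 / (1 - γ ^ (1 / L)) ≤ 1 / ((1 - γ) / L) := by
        refine one_div_le_one_div_of_le (by positivity) ?_
        linear_combination bernoulli
    _ = L / (1 - γ) := one_div_div _ _
    _ ≤ (L + 2) / (1 - γ) := by gcongr; linarith
end

section
/- Let A be a nonempty finite set, let p be a probability distribution on A, let Q : A → ℝ satisfy |Q(a)| ≤ Q_max for all a ∈ A for some Q_max ≥ 0, and let η > 0. Define the tilted distribution p' on A by p'(a) = p(a)·exp(−η·Q(a)) / ∑_{a' ∈ A} p(a')·exp(−η·Q(a')). Then ∑_{a ∈ A} |p'(a) − p(a)| ≤ η·Q_max. -/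
theorem two_mul_sub_one_sq_le_mul_log {u : ℝ} (hu : 0 < u) :
    2 * (u - 1) ^ 2 ≤ (u + 1) * ((u - 1) * Real.log u) := by
  rcases le_total 1 u with h | h
  · have key := Real.le_log_one_add_of_nonneg (sub_nonneg.2 h)
    rw [add_sub_cancel, div_le_iff₀ (by linarith)] at key
    nlinarith [mul_le_mul_of_nonneg_left key (sub_nonneg.2 h)]
  · have key := Real.le_log_one_add_of_nonneg (sub_nonneg.2 ((one_le_inv₀ hu).2 h))
    rw [add_sub_cancel, Real.log_inv] at key
    have hfrac : 2 * (u⁻¹ - 1) / (u⁻¹ - 1 + 2) = 2 * (1 - u) / (1 + u) := by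
      have : u⁻¹ - 1 + 2 ≠ 0 := by linarith [inv_pos.2 hu]
      rw [div_eq_div_iff this (by linarith)]
      field_simp
      ring
    rw [hfrac, div_le_iff₀ (by linarith)] at key
    nlinarith [mul_le_mul_of_nonneg_left key (sub_nonneg.2 h)]

/-- A Pinsker inequality for the symmetrized Kullback-Leibler divergence between `p` and the
distribution with density `u` with respect to `p`. -/
theorem sq_sum_abs_le_sum_mul_log {A : Type*} [Fintype A] {p u : A → ℝ}
    (hp0 : ∀ a, 0 ≤ p a) (hp1 : ∑ a, p a = 1) (hu : ∀ a, 0 < u a) (hpu : ∑ a, p a * u a = 1) :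
    (∑ a, |p a * u a - p a|) ^ 2 ≤ ∑ a, (p a * u a - p a) * Real.log (u a) := by
  have hsum : ∑ a, p a * (u a + 1) = 2 := by
    simp only [mul_add, mul_one, Finset.sum_add_distrib, hp1, hpu]
    norm_num
  have hcs : (∑ a, |p a * u a - p a|) ^ 2 ≤
      (∑ a, p a * ((u a - 1) ^ 2 / (u a + 1))) * ∑ a, p a * (u a + 1) := by
    refine Finset.sum_sq_le_sum_mul_sum_of_sq_le_mul _ (fun a _ => ?_) (fun a _ => ?_)
      (fun a _ => le_of_eq ?_)
    · have := hu a
      exact mul_nonneg (hp0 a) (by positivity)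
    · exact mul_nonneg (hp0 a) (by linarith [hu a])
    · have : u a + 1 ≠ 0 := by linarith [hu a]
      rw [sq_abs]
      field_simp
  rw [hsum, Finset.sum_mul] at hcs
  refine hcs.trans (Finset.sum_le_sum fun a _ => ?_)
  have hdiv : 2 * (u a - 1) ^ 2 / (u a + 1) ≤ (u a - 1) * Real.log (u a) := by
    rw [div_le_iff₀ (by linarith [hu a])]
    linarith [two_mul_sub_one_sq_le_mul_log (hu a)]
  calc p a * ((u a - 1) ^ 2 / (u a + 1)) * 2 = p a * (2 * (u a - 1) ^ 2 / (u a + 1)) := by ring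
    _ ≤ p a * ((u a - 1) * Real.log (u a)) := mul_le_mul_of_nonneg_left hdiv (hp0 a)
    _ = (p a * u a - p a) * Real.log (u a) := by ring


/-- Slow-change (stability) of the multiplicative-weights update in total
variation: the exponentially tilted distribution is within `η · Q_max` of the
original distribution in ℓ₁ distance. -/
theorem tilted_tv_le {A : Type*} [Fintype A] [Nonempty A]
    (p : A → ℝ) (hp0 : ∀ a, 0 ≤ p a) (hp1 : ∑ a, p a = 1)
    (Q : A → ℝ) (Qmax : ℝ) (hQmax : 0 ≤ Qmax) (hQ : ∀ a, |Q a| ≤ Qmax)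
    (η : ℝ) (hη : 0 < η)
    (p' : A → ℝ)
    (hp' : ∀ a, p' a = p a * Real.exp (-η * Q a) /
      ∑ a' : A, p a' * Real.exp (-η * Q a')) :
    ∑ a, |p' a - p a| ≤ η * Qmax := by
  set Z := ∑ a' : A, p a' * Real.exp (-η * Q a')
  have hZ : 0 < Z := by
    refine lt_of_lt_of_le (Real.exp_pos (-(η * Qmax))) ?_
    rw [← one_mul (Real.exp _), ← hp1, Finset.sum_mul]
    refine Finset.sum_le_sum fun a _ => mul_le_mul_of_nonneg_left (Real.exp_le_exp.2 ?_) (hp0 a)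
    nlinarith [(abs_le.1 (hQ a)).2]
  have hp'u : ∀ a, p' a = p a * (Real.exp (-η * Q a) / Z) := fun a => by rw [hp', mul_div_assoc]
  have hp'1 : ∑ a, p' a = 1 := by
    simp only [hp', ← Finset.sum_div]
    exact div_self hZ.ne'
  have hpinsker := sq_sum_abs_le_sum_mul_log hp0 hp1
    (fun a => div_pos (Real.exp_pos (-η * Q a)) hZ) (by simpa only [hp'u] using hp'1)
  simp only [← hp'u, Real.log_div (Real.exp_pos _).ne' hZ.ne', Real.log_exp, mul_sub,
    Finset.sum_sub_distrib, ← Finset.sum_mul, hp'1, hp1, sub_self, zero_mul, sub_zero] at hpinsker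
  have hbound : ∑ a, (p' a - p a) * (-η * Q a) ≤ (∑ a, |p' a - p a|) * (η * Qmax) := by
    rw [Finset.sum_mul]
    refine Finset.sum_le_sum fun a _ => (le_abs_self _).trans ?_
    rw [abs_mul, abs_mul, abs_neg, abs_of_pos hη]
    gcongr
    exact hQ a
  have hc : 0 ≤ η * Qmax := by positivity
  by_contra! hlt
  nlinarith
end

section
/- Let A be a nonempty finite set, let p be a probability distribution on A, let Q : A → ℝ be any function, and let η > 0. Define the tilted distribution p' on A by p'(a) = p(a)·exp(−η·Q(a)) / ∑_{a' ∈ A} p(a')·exp(−η·Q(a')). Then the Kullback–Leibler divergence KL(p' ‖ p) = ∑_{a ∈ A} p'(a)·log( p'(a) / p(a) ) (with the convention 0·log 0 = 0) satisfies KL(p' ‖ p) ≤ η·∑_{a ∈ A} Q(a)·( p(a) − p'(a) ). -/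
/-- **Jensen's inequality** for the logarithm of an exponential moment on a finite type. -/
theorem sum_mul_le_log_sum_mul_exp {A : Type*} [Fintype A] (p f : A → ℝ)
    (hp0 : ∀ a, 0 ≤ p a) (hp1 : ∑ a, p a = 1) :
    ∑ a, p a * f a ≤ Real.log (∑ a, p a * Real.exp (f a)) := by
  have jensen := convexOn_exp.map_sum_le (t := Finset.univ) (w := p) (p := f)
    (fun a _ => hp0 a) hp1 (fun _ _ => Set.mem_univ _)
  simp only [smul_eq_mul] at jensen
  exact (Real.le_log_iff_exp_le ((Real.exp_pos _).trans_le jensen)).2 jensen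

/-- KL divergence between an exponential tilt and the original distribution is
bounded by `η` times the correlation gap: `KL(p' ‖ p) ≤ η ∑ Q(a) (p(a) − p'(a))`. -/
theorem kl_tilted_le {A : Type*} [Fintype A] [Nonempty A]
    (p : A → ℝ) (hp0 : ∀ a, 0 ≤ p a) (hp1 : ∑ a, p a = 1)
    (Q : A → ℝ) (η : ℝ) (hη : 0 < η)
    (p' : A → ℝ)
    (hp' : ∀ a, p' a = p a * Real.exp (-η * Q a) /
      ∑ a' : A, p a' * Real.exp (-η * Q a')) :
    ∑ a, p' a * Real.log (p' a / p a) ≤ η * ∑ a, Q a * (p a - p' a) := by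
  have log_bound := sum_mul_le_log_sum_mul_exp p (fun a => -η * Q a) hp0 hp1
  have Z_pos : 0 < ∑ a, p a * Real.exp (-η * Q a) := by
    obtain ⟨a, -, ha⟩ : ∃ a ∈ Finset.univ, 0 < p a :=
      Finset.exists_lt_of_sum_lt (by simp [hp1])
    exact Finset.sum_pos' (fun b _ => mul_nonneg (hp0 b) (Real.exp_pos _).le)
      ⟨a, Finset.mem_univ a, mul_pos ha (Real.exp_pos _)⟩
  set Z := ∑ a, p a * Real.exp (-η * Q a) with hZ
  have sum_p' : ∑ a, p' a = 1 := by
    simp only [hp', ← Finset.sum_div]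
    exact div_self Z_pos.ne'
  have term_eq (a : A) :
      p' a * Real.log (p' a / p a) = -η * (Q a * p' a) - p' a * Real.log Z := by
    rcases (hp0 a).eq_or_lt with ha | ha
    · simp [hp', ← ha]
    · have ratio : p' a / p a = Real.exp (-η * Q a) / Z := by
        rw [hp']
        field_simp
      rw [ratio, Real.log_div (Real.exp_pos _).ne' Z_pos.ne', Real.log_exp]
      ring
  have mean_eq : ∑ a, p a * (-η * Q a) = -η * ∑ a, Q a * p a := by
    rw [Finset.mul_sum]
    exact Finset.sum_congr rfl fun a _ => by ring
  simp only [term_eq, mul_sub, Finset.sum_sub_distrib, ← Finset.mul_sum, ← Finset.sum_mul,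
    sum_p']
  linarith
end

section
/- (Extended performance difference lemma.) Work in the finite discounted MDP setup. Let π and π' be policies, let c : S × A → ℝ be a cost function, let d : S × A → ℝ be an occupancy measure of π', and let V' : S → ℝ be a value function of π' under c. Let Q̂ : S × A → ℝ be arbitrary and define V̂ : S → ℝ by V̂(s) = ∑_{a ∈ A} π(s)(a)·Q̂(s,a). Then (1 − γ)·∑_{s ∈ S} ν₀(s)·( V̂(s) − V'(s) ) = ∑_{(s,a) ∈ S×A} d(s,a)·( Q̂(s,a) − c(s,a) − γ·∑_{s' ∈ S} P(s,a)(s')·V̂(s') ) + ∑_{s ∈ S} ( ∑_{b ∈ A} d(s,b) )·∑_{a ∈ A} Q̂(s,a)·( π(s)(a) − π'(s)(a) ). -/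
/-- Summing a function `W` of the state along the discounted flow equation: `d` pairs with the
Bellman residual of `W` to give `(1 - γ)` times the initial expectation of `W`. -/
theorem sum_mul_sub_of_discounted_flow {S A : Type*} [Fintype S] [Fintype A]
    {γ : ℝ} {ν₀ : S → ℝ} {P : S → A → S → ℝ} {d : S → A → ℝ}
    (hd : ∀ s, ∑ a, d s a = (1 - γ) * ν₀ s + γ * ∑ s', ∑ a', P s' a' s * d s' a')
    (W : S → ℝ) :
    ∑ s, ∑ a, d s a * (W s - γ * ∑ s', P s a s' * W s') = (1 - γ) * ∑ s, ν₀ s * W s := by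
  have hflow : ∑ s, (∑ s', ∑ a', P s' a' s * d s' a') * W s =
      ∑ s, ∑ a, d s a * ∑ s', P s a s' * W s' := by
    simp only [Finset.sum_mul, Finset.mul_sum]
    rw [Finset.sum_comm]
    refine Finset.sum_congr rfl fun s _ => ?_
    rw [Finset.sum_comm]
    exact Finset.sum_congr rfl fun a _ => Finset.sum_congr rfl fun s' _ => by ring
  calc
    _ = ∑ s, (∑ a, d s a) * W s - γ * ∑ s, ∑ a, d s a * ∑ s', P s a s' * W s' := by
      simp only [mul_sub, Finset.sum_sub_distrib, Finset.sum_mul, mul_left_comm _ γ,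
        ← Finset.mul_sum]
    _ = _ := by
      simp only [hd, add_mul, Finset.sum_add_distrib, mul_assoc, ← Finset.mul_sum, hflow]
      ring

/-- Extended performance difference lemma for finite discounted MDPs, allowing an
inexact state-action value function `Q̂`. -/
theorem extended_performance_difference
    {S A : Type*} [Fintype S] [Fintype A] [Nonempty S] [Nonempty A]
    (γ : ℝ) (hγ0 : 0 ≤ γ) (hγ1 : γ < 1)
    (ν₀ : S → ℝ) (hν0 : ∀ s, 0 ≤ ν₀ s) (hν1 : ∑ s, ν₀ s = 1)
    (P : S → A → S → ℝ) (hP0 : ∀ s a s', 0 ≤ P s a s')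
    (hP1 : ∀ s a, ∑ s', P s a s' = 1)
    (π π' : S → A → ℝ)
    (hπ0 : ∀ s a, 0 ≤ π s a) (hπ1 : ∀ s, ∑ a, π s a = 1)
    (hπ'0 : ∀ s a, 0 ≤ π' s a) (hπ'1 : ∀ s, ∑ a, π' s a = 1)
    (c : S → A → ℝ)
    -- d is an occupancy measure of π'
    (d : S → A → ℝ)
    (hd1 : ∀ s a, d s a = (∑ b, d s b) * π' s a)
    (hd2 : ∀ s, ∑ a, d s a =
      (1 - γ) * ν₀ s + γ * ∑ s', ∑ a', P s' a' s * d s' a')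
    -- V' is a value function of π' under c
    (V' : S → ℝ)
    (hV' : ∀ s, V' s = ∑ a, π' s a * (c s a + γ * ∑ s', P s a s' * V' s'))
    (Qhat : S → A → ℝ) (Vhat : S → ℝ)
    (hVhat : ∀ s, Vhat s = ∑ a, π s a * Qhat s a) :
    (1 - γ) * ∑ s, ν₀ s * (Vhat s - V' s) =
      (∑ s, ∑ a, d s a * (Qhat s a - c s a - γ * ∑ s', P s a s' * Vhat s')) +
      ∑ s, (∑ b, d s b) * ∑ a, Qhat s a * (π s a - π' s a) := by
  have havg (f : A → ℝ) (s : S) : ∑ a, d s a * f a = (∑ b, d s b) * ∑ a, π' s a * f a := by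
    rw [Finset.mul_sum]
    exact Finset.sum_congr rfl fun a _ => by rw [hd1 s a, mul_assoc]
  simp only [mul_sub (ν₀ _), Finset.sum_sub_distrib]
  rw [mul_sub, ← sum_mul_sub_of_discounted_flow hd2 Vhat,
    ← sum_mul_sub_of_discounted_flow hd2 V', ← Finset.sum_sub_distrib,
    ← Finset.sum_add_distrib]
  refine Finset.sum_congr rfl fun s _ => ?_
  have hV : (∑ a, d s a) * V' s = ∑ a, d s a * (c s a + γ * ∑ s', P s a s' * V' s') := by
    rw [havg, ← hV']
  have hQ : ∑ a, Qhat s a * (π s a - π' s a) = Vhat s - ∑ a, π' s a * Qhat s a := by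
    simp only [hVhat, mul_sub, Finset.sum_sub_distrib, mul_comm]
  rw [hQ, mul_sub, ← havg]
  simp only [mul_sub, mul_add, Finset.sum_sub_distrib, Finset.sum_add_distrib,
    ← Finset.sum_mul] at hV ⊢
  linarith
end

section
/- Let n be a natural number and p ∈ [0, 1]. Let B be a random variable with the binomial distribution with n trials and success probability p (i.e., ℙ(B = j) = C(n, j)·p^j·(1−p)^{n−j} for j ∈ {0, …, n}). Then ℙ( B ≤ (n + 2)·p ) ≥ 1/4. Equivalently, the shifted empirical frequency estimator p̂ = B/(n + 2) underestimates p with probability at least 1/4. -/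
open MeasureTheory

/-- The probability, as a polynomial in the success probability, that a binomial variable with
`n` trials is at most `k`. -/
noncomputable def binomialCDF (n k : ℕ) : Polynomial ℝ :=
  ∑ j ∈ Finset.range (k + 1), bernsteinPolynomial ℝ n j

lemma bernsteinPolynomial_eval (n j : ℕ) (x : ℝ) :
    (bernsteinPolynomial ℝ n j).eval x = (n.choose j : ℝ) * x ^ j * (1 - x) ^ (n - j) := by
  simp [bernsteinPolynomial]

lemma bernsteinPolynomial_eval_nonneg (n j : ℕ) {x : ℝ} (h0 : 0 ≤ x) (h1 : x ≤ 1) :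
    0 ≤ (bernsteinPolynomial ℝ n j).eval x := by
  have := sub_nonneg.2 h1
  rw [bernsteinPolynomial_eval]
  positivity

lemma binomialCDF_eval (n k : ℕ) (x : ℝ) :
    (binomialCDF n k).eval x =
      ∑ j ∈ Finset.range (k + 1), (bernsteinPolynomial ℝ n j).eval x :=
  Polynomial.eval_finsetSum _ _ _

lemma derivative_binomialCDF (n k : ℕ) :
    Polynomial.derivative (binomialCDF (n + 1) k) =
      -((n + 1 : ℕ) : Polynomial ℝ) * bernsteinPolynomial ℝ n k := by
  induction k with
  | zero => simp [binomialCDF, bernsteinPolynomial.derivative_zero]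
  | succ k ih =>
    rw [binomialCDF, Finset.sum_range_succ, Polynomial.derivative_add, ← binomialCDF, ih,
      bernsteinPolynomial.derivative_succ]
    simp only [Nat.add_sub_cancel]
    ring

lemma hasDerivAt_binomialCDF (n k : ℕ) (x : ℝ) :
    HasDerivAt (fun y ↦ (binomialCDF (n + 1) k).eval y)
      (-((n + 1) * (bernsteinPolynomial ℝ n k).eval x)) x := by
  have h := (binomialCDF (n + 1) k).hasDerivAt x
  rw [derivative_binomialCDF] at h
  refine h.congr_deriv ?_
  rw [Polynomial.eval_mul, Polynomial.eval_neg, Polynomial.eval_natCast]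
  push_cast
  ring

lemma binomialCDF_eval_zero (n k : ℕ) : (binomialCDF n k).eval 0 = 1 := by
  rw [binomialCDF_eval]
  simp [bernsteinPolynomial.eval_at_0]

lemma binomialCDF_eval_one {n k : ℕ} (h : k < n) : (binomialCDF n k).eval 1 = 0 := by
  rw [binomialCDF_eval]
  refine Finset.sum_eq_zero fun j hj ↦ ?_
  have := Finset.mem_range.1 hj
  rw [bernsteinPolynomial.eval_at_1, if_neg (by omega)]

lemma binomialCDF_eval_self (n : ℕ) (x : ℝ) : (binomialCDF n n).eval x = 1 := by
  rw [binomialCDF, bernsteinPolynomial.sum, Polynomial.eval_one]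

lemma binomialCDF_eval_mono (n : ℕ) {x : ℝ} (h0 : 0 ≤ x) (h1 : x ≤ 1) :
    Monotone fun k ↦ (binomialCDF n k).eval x := by
  intro k l hkl
  simp only [binomialCDF_eval]
  exact Finset.sum_le_sum_of_subset_of_nonneg (Finset.range_mono (by omega))
    fun j _ _ ↦ bernsteinPolynomial_eval_nonneg n j h0 h1

/-- The hazard rate of the binomial distribution function, seen as a function of the success
probability, is monotone. -/
lemma binomialCDF_hazard_mono {n k : ℕ} (hk : k ≤ n) {x y : ℝ} (hx : 0 ≤ x) (hxy : x ≤ y)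
    (hy : y ≤ 1) :
    (binomialCDF (n + 1) k).eval y * (bernsteinPolynomial ℝ n k).eval x ≤
      (binomialCDF (n + 1) k).eval x * (bernsteinPolynomial ℝ n k).eval y := by
  simp only [binomialCDF_eval, Finset.sum_mul]
  refine Finset.sum_le_sum fun j hj ↦ ?_
  obtain ⟨i, rfl⟩ := Nat.exists_eq_add_of_le (Nat.lt_succ_iff.1 (Finset.mem_range.1 hj))
  obtain ⟨m, rfl⟩ := Nat.exists_eq_add_of_le hk
  have h1 : j + i + m + 1 - j = i + 1 + m := by omega
  simp only [bernsteinPolynomial_eval, h1, Nat.add_sub_cancel_left]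
  have hx' : 0 ≤ 1 - x := by linarith
  have hy' : 0 ≤ 1 - y := by linarith
  have hy0 : 0 ≤ y := hx.trans hxy
  have key : (1 - y) ^ (i + 1) * x ^ i ≤ (1 - x) ^ (i + 1) * y ^ i := by gcongr
  have hc : 0 ≤ ((j + i + m + 1).choose j : ℝ) * ((j + i + m).choose (j + i) : ℝ) *
      (x ^ j * y ^ j * (1 - x) ^ m * (1 - y) ^ m) := by positivity
  have := mul_le_mul_of_nonneg_left key hc
  simp only [pow_add, pow_one] at this ⊢
  linarith

/-- Tangent bound expressing log-concavity of the binomial distribution function, seen as a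
function of the success probability. -/
lemma binomialCDF_mul_exp_le {n k : ℕ} (hk : k ≤ n) {p a : ℝ} (hp0 : 0 ≤ p) (hp1 : p ≤ 1)
    (hs : 0 < (binomialCDF (n + 1) k).eval p)
    (ha : a * (binomialCDF (n + 1) k).eval p = (n + 1) * (bernsteinPolynomial ℝ n k).eval p)
    {x : ℝ} (hx0 : 0 ≤ x) (hx1 : x ≤ 1) :
    (binomialCDF (n + 1) k).eval x * Real.exp (a * (x - p)) ≤
      (binomialCDF (n + 1) k).eval p := by
  set S := fun y ↦ (binomialCDF (n + 1) k).eval y with hS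
  set b := fun y ↦ (bernsteinPolynomial ℝ n k).eval y with hb
  have hd : ∀ y, HasDerivAt (fun y ↦ S y * Real.exp (a * (y - p)))
      ((a * S y - (n + 1) * b y) * Real.exp (a * (y - p))) y := fun y ↦ by
    have he : HasDerivAt (fun y ↦ Real.exp (a * (y - p))) (Real.exp (a * (y - p)) * (a * 1)) y :=
      (((hasDerivAt_id y).sub_const p).const_mul a).exp
    refine ((hasDerivAt_binomialCDF n k y).mul he).congr_deriv ?_
    simp only [hS, hb]
    ring
  have hsign : ∀ y, S p * (a * S y - (n + 1) * b y) = (n + 1) * (S y * b p - S p * b y) := by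
    intro y
    linear_combination S y * ha
  have hn : (0 : ℝ) ≤ n + 1 := by positivity
  have hcont : Continuous fun y ↦ S y * Real.exp (a * (y - p)) :=
    continuous_iff_continuousAt.2 fun y ↦ (hd y).continuousAt
  have hp : S p * Real.exp (a * (p - p)) = S p := by simp
  change S x * Real.exp (a * (x - p)) ≤ S p
  rw [← hp]
  rcases le_total x p with hxp | hpx
  · have hm : MonotoneOn (fun y ↦ S y * Real.exp (a * (y - p))) (Set.Icc 0 p) := by
      refine monotoneOn_of_deriv_nonneg (convex_Icc _ _) hcont.continuousOn
        (fun y _ ↦ (hd y).differentiableAt.differentiableWithinAt) fun y hy ↦ ?_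
      rw [interior_Icc] at hy
      rw [(hd y).deriv]
      refine mul_nonneg ((mul_nonneg_iff_of_pos_left hs).1 ?_) (Real.exp_pos _).le
      rw [hsign]
      exact mul_nonneg hn (sub_nonneg.2 (binomialCDF_hazard_mono hk hy.1.le hy.2.le hp1))
    exact hm ⟨hx0, hxp⟩ ⟨hp0, le_rfl⟩ hxp
  · have hm : AntitoneOn (fun y ↦ S y * Real.exp (a * (y - p))) (Set.Icc p 1) := by
      refine antitoneOn_of_deriv_nonpos (convex_Icc _ _) hcont.continuousOn
        (fun y _ ↦ (hd y).differentiableAt.differentiableWithinAt) fun y hy ↦ ?_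
      rw [interior_Icc] at hy
      rw [(hd y).deriv]
      refine mul_nonpos_of_nonpos_of_nonneg (nonpos_of_mul_nonpos_right (a := S p) ?_ hs)
        (Real.exp_pos _).le
      rw [hsign]
      exact mul_nonpos_of_nonneg_of_nonpos hn
        (sub_nonpos.2 (binomialCDF_hazard_mono hk hp0 hy.1.le hy.2.le))
    exact hm ⟨le_rfl, hp1⟩ ⟨hpx, hx1⟩ hpx

/-- An explicit antiderivative of the binomial distribution function, whose increment over
`[0, 1]` is the mean of the associated Beta distribution. -/
lemma exists_antiderivative_binomialCDF {n k : ℕ} (hk : k ≤ n) :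
    ∃ Φ : ℝ → ℝ, (∀ x, HasDerivAt Φ ((binomialCDF n k).eval x) x) ∧
      Φ 1 - Φ 0 = (k + 1) / (n + 1) := by
  have hn : (n + 1 : ℝ) ≠ 0 := by positivity
  refine ⟨fun x ↦ -(∑ j ∈ Finset.range (k + 1), (binomialCDF (n + 1) j).eval x) / (n + 1),
    fun x ↦ ?_, ?_⟩
  · refine ((HasDerivAt.fun_sum fun j (_ : j ∈ Finset.range (k + 1)) ↦
      hasDerivAt_binomialCDF n j x).neg.div_const (n + 1 : ℝ)).congr_deriv ?_
    rw [Finset.sum_neg_distrib, ← Finset.mul_sum, ← binomialCDF_eval]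
    field_simp
  · have h1 : ∑ j ∈ Finset.range (k + 1), (binomialCDF (n + 1) j).eval 1 = 0 :=
      Finset.sum_eq_zero fun j hj ↦ binomialCDF_eval_one (by
        have := Finset.mem_range.1 hj
        omega)
    simp only [h1, binomialCDF_eval_zero, Finset.sum_const, Finset.card_range, nsmul_eq_mul]
    push_cast
    ring

/-- Grünbaum's inequality for the binomial distribution function. -/
lemma exp_neg_one_le_binomialCDF (n k : ℕ) {p : ℝ} (hp0 : 0 ≤ p) (hp1 : p ≤ 1)
    (hpk : p * (n + 1) ≤ k + 1) :
    Real.exp (-1) ≤ (binomialCDF n k).eval p := by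
  have hle1 : Real.exp (-1) ≤ 1 := Real.exp_le_one_iff.2 (by norm_num)
  rcases le_or_gt n k with hnk | hkn
  · exact hle1.trans ((binomialCDF_eval_self n p).symm.trans_le
      (binomialCDF_eval_mono n hp0 hp1 hnk))
  rcases hp0.eq_or_lt with rfl | hp
  · rwa [binomialCDF_eval_zero]
  obtain ⟨Φ, hΦ, hΦ01⟩ := exists_antiderivative_binomialCDF hkn.le
  have hpμ : p ≤ (k + 1) / (n + 1) := (le_div_iff₀ (by positivity)).2 hpk
  have hp' : p < 1 := by
    refine hpμ.trans_lt ((div_lt_one (by positivity)).2 ?_)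
    have : (k : ℝ) < n := by exact_mod_cast hkn
    linarith
  obtain ⟨N, rfl⟩ : ∃ N, n = N + 1 := ⟨n - 1, by omega⟩
  have hkN : k ≤ N := by omega
  have hS1 : ∀ x : ℝ, 0 ≤ x → x ≤ 1 → (binomialCDF (N + 1) k).eval x ≤ 1 := fun x h0 h1 ↦
    (binomialCDF_eval_mono (N + 1) h0 h1 hkn.le).trans_eq (binomialCDF_eval_self _ x)
  have hq : 0 < 1 - p := by linarith
  have hs : 0 < (binomialCDF (N + 1) k).eval p := by
    refine lt_of_lt_of_le ?_ (binomialCDF_eval_mono (N + 1) hp0 hp1 (Nat.zero_le k))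
    simp only [binomialCDF, zero_add, Finset.sum_range_one, bernsteinPolynomial_eval]
    simp only [Nat.choose_zero_right, Nat.cast_one, pow_zero]
    positivity
  have hb : 0 < (bernsteinPolynomial ℝ N k).eval p := by
    have := Nat.choose_pos hkN
    rw [bernsteinPolynomial_eval]
    positivity
  set s := (binomialCDF (N + 1) k).eval p with hs_def
  obtain ⟨a, ha, has⟩ : ∃ a : ℝ, 0 < a ∧ a * s = (N + 1) * (bernsteinPolynomial ℝ N k).eval p :=
    ⟨(N + 1) * (bernsteinPolynomial ℝ N k).eval p / s, by positivity, by field_simp⟩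
  have htan := fun {x : ℝ} (h0 : 0 ≤ x) (h1 : x ≤ 1) ↦
    binomialCDF_mul_exp_le hkN hp0 hp1 hs has h0 h1
  rw [← Real.le_log_iff_exp_le hs]
  have hlog : Real.log s ≤ 0 := Real.log_nonpos hs.le (hS1 p hp0 hp1)
  have hlog' : -(a * p) ≤ Real.log s := by
    rw [Real.le_log_iff_exp_le hs]
    simpa [binomialCDF_eval_zero] using htan le_rfl zero_le_one
  -- the tangent exponential at `p` equals `1` at `x₀`
  set x₀ := p + Real.log s / a with hx₀
  have hax₀ : a * (x₀ - p) = Real.log s := by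
    rw [hx₀]
    field_simp
    ring
  have hx₀0 : 0 ≤ x₀ := by
    refine (mul_nonneg_iff_of_pos_left ha).1 ?_
    linarith
  have hx₀p : x₀ ≤ p := by
    have := div_nonpos_of_nonpos_of_nonneg hlog ha.le
    linarith
  have hx₀1 : x₀ ≤ 1 := hx₀p.trans hp1
  have hleft : Φ x₀ - Φ 0 ≤ x₀ := by
    have hd : ∀ x, HasDerivAt (fun x ↦ Φ x - x) ((binomialCDF (N + 1) k).eval x - 1) x :=
      fun x ↦ (hΦ x).sub (hasDerivAt_id x)
    have hm : AntitoneOn (fun x ↦ Φ x - x) (Set.Icc 0 1) := by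
      refine antitoneOn_of_deriv_nonpos (convex_Icc _ _)
        (fun x _ ↦ (hd x).continuousAt.continuousWithinAt)
        (fun x _ ↦ (hd x).differentiableAt.differentiableWithinAt) fun x hx ↦ ?_
      rw [interior_Icc] at hx
      rw [(hd x).deriv]
      linarith [hS1 x hx.1.le hx.2.le]
    have := hm ⟨le_rfl, zero_le_one⟩ ⟨hx₀0, hx₀1⟩ hx₀0
    simp only at this
    linarith
  have hright : Φ 1 - Φ x₀ ≤ 1 / a := by
    have hd : ∀ x, HasDerivAt (fun x ↦ Φ x + s / a * Real.exp (-(a * (x - p))))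
        ((binomialCDF (N + 1) k).eval x - s * Real.exp (-(a * (x - p)))) x := fun x ↦ by
      have he : HasDerivAt (fun x ↦ Real.exp (-(a * (x - p))))
          (Real.exp (-(a * (x - p))) * -(a * 1)) x :=
        (((hasDerivAt_id x).sub_const p).const_mul a).neg.exp
      refine ((hΦ x).add (he.const_mul (s / a))).congr_deriv ?_
      field_simp
      ring
    have hm : AntitoneOn (fun x ↦ Φ x + s / a * Real.exp (-(a * (x - p)))) (Set.Icc 0 1) := by
      refine antitoneOn_of_deriv_nonpos (convex_Icc _ _)
        (fun x _ ↦ (hd x).continuousAt.continuousWithinAt)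
        (fun x _ ↦ (hd x).differentiableAt.differentiableWithinAt) fun x hx ↦ ?_
      rw [interior_Icc] at hx
      rw [(hd x).deriv, sub_nonpos, Real.exp_neg, ← div_eq_mul_inv, le_div_iff₀ (Real.exp_pos _)]
      exact htan hx.1.le hx.2.le
    have h := hm ⟨hx₀0, hx₀1⟩ ⟨zero_le_one, le_rfl⟩ hx₀1
    have hx₀exp : s / a * Real.exp (-(a * (x₀ - p))) = 1 / a := by
      rw [hax₀, Real.exp_neg, Real.exp_log hs]
      field_simp
    simp only [hx₀exp] at h
    have : 0 ≤ s / a * Real.exp (-(a * (1 - p))) := by positivity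
    linarith
  have hfin : 0 ≤ (Real.log s + 1) / a := by
    rw [add_div]
    linarith
  have := (le_div_iff₀ ha).1 hfin
  linarith

/-- Anti-concentration of the shifted binomial frequency estimator: a binomial
random variable with `n` trials and success probability `p` satisfies
`B ≤ (n + 2) p` with probability at least `1/4`. -/
theorem binomial_underestimates
    (n : ℕ) (p : ℝ) (hp0 : 0 ≤ p) (hp1 : p ≤ 1)
    {Ω : Type*} [MeasurableSpace Ω] (ℙ : Measure Ω) [IsProbabilityMeasure ℙ]
    (B : Ω → ℕ) (hmeas : Measurable B)
    (hbin : ∀ j : ℕ, ℙ {ω | B ω = j} =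
      ENNReal.ofReal ((n.choose j : ℝ) * p ^ j * (1 - p) ^ (n - j))) :
    ENNReal.ofReal (1 / 4 : ℝ) ≤ ℙ {ω | (B ω : ℝ) ≤ ((n : ℝ) + 2) * p} := by
  set k := ⌊((n : ℝ) + 2) * p⌋₊ with hk
  have hset : {ω | (B ω : ℝ) ≤ ((n : ℝ) + 2) * p} =
      ⋃ j ∈ Finset.range (k + 1), {ω | B ω = j} := by
    ext ω
    simp [← Nat.le_floor_iff (show 0 ≤ ((n : ℝ) + 2) * p by positivity), ← hk]
  have hprob : ℙ {ω | (B ω : ℝ) ≤ ((n : ℝ) + 2) * p} =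
      ENNReal.ofReal ((binomialCDF n k).eval p) := by
    rw [hset, measure_biUnion_finset, binomialCDF_eval, ENNReal.ofReal_sum_of_nonneg
      fun j _ ↦ bernsteinPolynomial_eval_nonneg n j hp0 hp1]
    · simp only [hbin, bernsteinPolynomial_eval]
    · intro i _ j _ hij
      refine Set.disjoint_left.2 fun ω hi hj ↦ hij ?_
      exact (show B ω = i from hi).symm.trans hj
    · exact fun j _ ↦ hmeas (measurableSet_singleton j)
  rw [hprob]
  refine ENNReal.ofReal_le_ofReal (le_trans ?_ (exp_neg_one_le_binomialCDF n k hp0 hp1 ?_))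
  · rw [Real.exp_neg, one_div]
    exact inv_anti₀ (Real.exp_pos _) (by linarith [Real.exp_one_lt_d9])
  · have := Nat.lt_floor_add_one (((n : ℝ) + 2) * p)
    rw [← hk] at this
    linarith
end
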